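/- (Monogamy of the Gaussian Rényi-2 entanglement of formation.) Let V_ABC be a quantum covariance matrix on n_A + n_B + n_C modes (relative to the partition of the phase-space coordinates into subsystems A, B, C), with principal submatrices V_{A(BC)} (on all coordinates, regarded as bipartite between A and BC), V_AB and V_AC. Then E^G_{F,2}(A:BC)_{V_ABC} ≥ E^G_{F,2}(A:B)_{V_AB} + E^G_{F,2}(A:C)_{V_AC}. -/

import Mathlib

open Matrix
open scoped ComplexOrder

/-- Embedding of the `AB` indices into the `ABC` indices. -/
def eAB {α β γ : Type*} : α ⊕ β → α ⊕ (β ⊕ γ) := Sum.map id Sum.inl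

/-- Embedding of the `AC` indices into the `ABC` indices. -/
def eAC {α β γ : Type*} : α ⊕ γ → α ⊕ (β ⊕ γ) := Sum.map id Sum.inr

/-- Log-det mutual information of a bipartite positive definite matrix. -/
noncomputable def IM2 {α β : Type*} [Fintype α] [Fintype β] [DecidableEq α] [DecidableEq β]
    (V : Matrix (α ⊕ β) (α ⊕ β) ℝ) : ℝ :=
  (1 / 2) * Real.log ((V.toBlocks₁₁.det * V.toBlocks₂₂.det) / V.det)

/-- The standard symplectic form on `n` modes. -/
def Omg (n : ℕ) : Matrix (Fin n ⊕ Fin n) (Fin n ⊕ Fin n) ℝ :=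
  fromBlocks 0 1 (-1) 0

/-- A real matrix is symplectic (with respect to a given form `Ω`) if `S Ω Sᵀ = Ω`. -/
def IsSymplectic {N : Type*} [Fintype N] (Ω S : Matrix N N ℝ) : Prop :=
  S * Ω * Sᵀ = Ω

/-- Complexification of a real matrix. -/
noncomputable def cplx {μ ν : Type*} (M : Matrix μ ν ℝ) : Matrix μ ν ℂ :=
  M.map (fun x => (x : ℂ))

/-- A quantum covariance matrix with respect to a symplectic form `Ω`: a real symmetric
matrix `V` with `V + iΩ ≥ 0`. -/
def IsQCM {N : Type*} [Fintype N] [DecidableEq N] (Ω V : Matrix N N ℝ) : Prop :=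
  V.IsSymm ∧ (cplx V + Complex.I • cplx Ω).PosSemidef

/-- A pure quantum covariance matrix: `V = S Sᵀ` with `S` symplectic. -/
def IsPureQCM {N : Type*} [Fintype N] (Ω V : Matrix N N ℝ) : Prop :=
  ∃ S, IsSymplectic Ω S ∧ V = S * Sᵀ

/-- The Gaussian Rényi-2 entanglement of formation of a bipartite QCM `V`, with respect
to the bipartite symplectic form `Ω`. -/
noncomputable def EF2 {α β : Type*} [Fintype α] [Fintype β] [DecidableEq α] [DecidableEq β]
    (Ω V : Matrix (α ⊕ β) (α ⊕ β) ℝ) : ℝ :=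
  sInf {x | ∃ γ : Matrix (α ⊕ β) (α ⊕ β) ℝ,
    IsPureQCM Ω γ ∧ (V - γ).PosSemidef ∧ x = (1 / 2) * IM2 γ}

section SquareRoot

variable {N : Type*} [Fintype N] [DecidableEq N]

open scoped MatrixOrder in
theorem Matrix.PosDef.exists_sq_eq {A : Matrix N N ℝ} (hA : A.PosDef) :
    ∃ H : Matrix N N ℝ, H.PosDef ∧ H * H = A := by
  have hsq : CFC.sqrt A * CFC.sqrt A = A := CFC.sqrt_mul_sqrt_self A hA.posSemidef.nonneg
  refine ⟨CFC.sqrt A, ?_, hsq⟩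
  have hps : (CFC.sqrt A).PosSemidef := Matrix.nonneg_iff_posSemidef.mp (CFC.sqrt_nonneg A)
  rw [hps.posDef_iff_det_ne_zero]
  intro h
  have := hA.det_pos
  rw [← hsq, det_mul, h] at this
  simp at this

open scoped MatrixOrder in
theorem Matrix.PosDef.eq_of_mul_self_eq {A B : Matrix N N ℝ} (hA : A.PosDef) (hB : B.PosDef)
    (h : A * A = B * B) : A = B := by
  rw [← CFC.sqrt_mul_self A hA.posSemidef.nonneg, h, CFC.sqrt_mul_self B hB.posSemidef.nonneg]

end SquareRoot

section Blocks

variable {m n : Type*}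

theorem Matrix.PosDef.toBlocks₁₁ {M : Matrix (m ⊕ n) (m ⊕ n) ℝ} (hM : M.PosDef) :
    M.toBlocks₁₁.PosDef :=
  hM.submatrix Sum.inl_injective

theorem Matrix.PosDef.toBlocks₂₂ {M : Matrix (m ⊕ n) (m ⊕ n) ℝ} (hM : M.PosDef) :
    M.toBlocks₂₂.PosDef :=
  hM.submatrix Sum.inr_injective

end Blocks

section Determinant

variable {m n : Type*} [Fintype m] [DecidableEq m] [Fintype n] [DecidableEq n]

theorem Matrix.PosDef.isUnit_det {A : Matrix m m ℝ} (hA : A.PosDef) : IsUnit A.det :=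
  hA.det_pos.ne'.isUnit

theorem Matrix.one_le_det_of_posSemidef_sub_one {C : Matrix m m ℝ}
    (h : (C - 1).PosSemidef) : 1 ≤ C.det := by
  have hC : C.IsHermitian := by
    have := h.isHermitian.add (isHermitian_one (n := m) (α := ℝ))
    simpa using this
  rw [hC.det_eq_prod_eigenvalues]
  refine Finset.one_le_prod fun i _ => ?_
  have h1 := h.dotProduct_mulVec_nonneg (hC.eigenvectorBasis i)
  rw [sub_mulVec, hC.mulVec_eigenvectorBasis, one_mulVec, dotProduct_sub, dotProduct_smul] at h1
  have h2 : star (hC.eigenvectorBasis i).ofLp ⬝ᵥ (hC.eigenvectorBasis i).ofLp = 1 := by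
    have := EuclideanSpace.inner_eq_star_dotProduct (hC.eigenvectorBasis i) (hC.eigenvectorBasis i)
    rw [dotProduct_comm, ← this, real_inner_self_eq_norm_sq, hC.eigenvectorBasis.norm_eq_one]
    simp
  rw [h2] at h1
  simpa using h1

/-- The determinant is monotone in the Löwner order on positive definite matrices. -/
theorem Matrix.PosDef.det_le_det {A B : Matrix m m ℝ} (hA : A.PosDef)
    (h : (B - A).PosSemidef) : A.det ≤ B.det := by
  obtain ⟨H, hH, rfl⟩ := hA.exists_sq_eq
  have hu := hH.isUnit_det
  have hHt : (H⁻¹)ᴴ = H⁻¹ := hH.inv.isHermitian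
  have key := h.mul_mul_conjTranspose_same H⁻¹
  have e : H⁻¹ * (B - H * H) * (H⁻¹)ᴴ = H⁻¹ * B * H⁻¹ - 1 := by
    rw [hHt, Matrix.mul_sub, Matrix.sub_mul, nonsing_inv_mul_cancel_left _ _ hu,
      mul_nonsing_inv _ hu]
  rw [e] at key
  have h1 := one_le_det_of_posSemidef_sub_one key
  rw [det_mul, det_mul, det_nonsing_inv, Ring.inverse_eq_inv'] at h1
  have hp := hH.det_pos
  rw [det_mul]
  field_simp at h1
  nlinarith

/-- Jacobi's complementary minor formula for block matrices. -/
theorem Matrix.det_mul_det_inv_toBlocks₂₂ (M : Matrix (m ⊕ n) (m ⊕ n) ℝ) (hM : IsUnit M.det) :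
    M.det * M⁻¹.toBlocks₂₂.det = M.toBlocks₁₁.det := by
  have h : M * M⁻¹ = 1 := mul_nonsing_inv _ hM
  obtain ⟨A, B, C, D, hM'⟩ : ∃ A B C D, M = fromBlocks A B C D :=
    ⟨_, _, _, _, (fromBlocks_toBlocks M).symm⟩
  obtain ⟨A', B', C', D', hN⟩ : ∃ A B C D, M⁻¹ = fromBlocks A B C D :=
    ⟨_, _, _, _, (fromBlocks_toBlocks M⁻¹).symm⟩
  rw [hN, hM', fromBlocks_multiply, ← fromBlocks_one, fromBlocks_inj] at h
  obtain ⟨-, h12, -, h22⟩ := h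
  have e : M * fromBlocks 1 B' 0 D' = fromBlocks A 0 C 1 := by
    rw [hM', fromBlocks_multiply, h12, h22]
    simp
  have := congrArg det e
  rw [det_mul, det_fromBlocks_zero₂₁, det_fromBlocks_zero₁₂, det_one, one_mul, det_one,
    mul_one] at this
  rw [hN, toBlocks_fromBlocks₂₂, this, hM', toBlocks_fromBlocks₁₁]

theorem Matrix.det_mul_det_inv_toBlocks₁₁ (M : Matrix (m ⊕ n) (m ⊕ n) ℝ) (hM : IsUnit M.det) :
    M.det * M⁻¹.toBlocks₁₁.det = M.toBlocks₂₂.det := by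
  have h := det_mul_det_inv_toBlocks₂₂ (M.submatrix (Equiv.sumComm n m) (Equiv.sumComm n m))
    (by rwa [det_submatrix_equiv_self])
  rw [det_submatrix_equiv_self, inv_submatrix_equiv] at h
  exact h

/-- Two positive definite matrices dominating `G` in the sense of the geometric mean satisfy
`det G ^ 2 ≤ det A * det B`. -/
theorem Matrix.det_sq_le_of_posSemidef_fromBlocks {A G B : Matrix m m ℝ} (hA : A.PosDef)
    (hG : G.PosDef) (h : (fromBlocks A G G B).PosSemidef) : G.det ^ 2 ≤ A.det * B.det := by
  have hGt : Gᴴ = G := hG.isHermitian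
  have : Invertible A := invertibleOfIsUnitDet _ hA.isUnit_det
  have h' : (fromBlocks A G Gᴴ B).PosSemidef := by rwa [hGt]
  rw [PosDef.fromBlocks₁₁ G B hA] at h'
  have hp : (Gᴴ * A⁻¹ * G).PosDef :=
    hA.inv.conjTranspose_mul_mul_same (mulVec_injective_of_isUnit hG.isUnit)
  have hd := hp.det_le_det h'
  rw [hGt, det_mul, det_mul, det_nonsing_inv, Ring.inverse_eq_inv'] at hd
  have := hA.det_pos
  field_simp at hd
  linarith

/-- Fischer's inequality. -/
theorem Matrix.PosDef.det_le_mul_det_toBlocks {M : Matrix (m ⊕ n) (m ⊕ n) ℝ} (hM : M.PosDef) :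
    M.det ≤ M.toBlocks₁₁.det * M.toBlocks₂₂.det := by
  have hB : M.toBlocks₂₁ = M.toBlocks₁₂ᴴ := by
    ext i j
    exact (hM.isHermitian.apply _ _).symm
  have hA := hM.toBlocks₁₁
  have : Invertible M.toBlocks₁₁ := invertibleOfIsUnitDet _ hA.isUnit_det
  have hdet : M.det = M.toBlocks₁₁.det *
      (M.toBlocks₂₂ - M.toBlocks₁₂ᴴ * M.toBlocks₁₁⁻¹ * M.toBlocks₁₂).det := by
    conv_lhs => rw [← fromBlocks_toBlocks M, hB]
    rw [det_fromBlocks₁₁, invOf_eq_nonsing_inv]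
  have hS : (M.toBlocks₂₂ - M.toBlocks₁₂ᴴ * M.toBlocks₁₁⁻¹ * M.toBlocks₁₂).PosSemidef := by
    rw [← PosDef.fromBlocks₁₁ _ _ hA, ← hB, fromBlocks_toBlocks]
    exact hM.posSemidef
  have hS' := hS.posDef_iff_det_ne_zero.mpr (fun h0 => hM.det_pos.ne' (by rw [hdet, h0, mul_zero]))
  rw [hdet]
  refine mul_le_mul_of_nonneg_left (hS'.det_le_det ?_) hA.det_pos.le
  rw [sub_sub_cancel]
  exact hA.inv.posSemidef.conjTranspose_mul_mul_same _

end Determinant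

theorem Matrix.PosSemidef.sub_of_fromBlocks {N : Type*} [Fintype N] {A B G : Matrix N N ℝ}
    (h : (fromBlocks A G G B).PosSemidef) (hAB : (A - B).PosSemidef) : (A - G).PosSemidef := by
  have hA : A.IsHermitian := (h.submatrix Sum.inl).isHermitian
  have hG : G.IsHermitian := by
    have := h.isHermitian.eq
    rw [fromBlocks_conjTranspose, fromBlocks_inj] at this
    exact this.2.1
  refine PosSemidef.of_dotProduct_mulVec_nonneg (hA.sub hG) fun x => ?_
  have h1 := h.dotProduct_mulVec_nonneg (Sum.elim x (-x))
  have h2 := hAB.dotProduct_mulVec_nonneg x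
  have e : star (Sum.elim x (-x)) ⬝ᵥ (fromBlocks A G G B *ᵥ Sum.elim x (-x)) =
      x ⬝ᵥ (A *ᵥ x) - 2 * x ⬝ᵥ (G *ᵥ x) + x ⬝ᵥ (B *ᵥ x) := by
    have hs : star (Sum.elim x (-x)) = Sum.elim x (-x) := by simp
    rw [hs, fromBlocks_mulVec, sumElim_dotProduct_sumElim]
    simp only [Sum.elim_comp_inl, Sum.elim_comp_inr, mulVec_neg, dotProduct_add, dotProduct_neg,
      neg_dotProduct]
    ring
  rw [e] at h1
  simp only [star_trivial, sub_mulVec, dotProduct_sub] at h2 ⊢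
  linarith

section Symplectic

/-- An antisymmetric orthogonal matrix, the abstract shape of a symplectic form. -/
structure IsSympForm {N : Type*} [Fintype N] [DecidableEq N] (Ω : Matrix N N ℝ) : Prop where
  transpose_eq : Ωᵀ = -Ω
  mul_transpose : Ω * Ωᵀ = 1

theorem IsSympForm.transpose_mul {N : Type*} [Fintype N] [DecidableEq N] {Ω : Matrix N N ℝ}
    (hΩ : IsSympForm Ω) : Ωᵀ * Ω = 1 :=
  mul_eq_one_comm.mp hΩ.mul_transpose

theorem IsSympForm.fromBlocks {α β : Type*} [Fintype α] [Fintype β] [DecidableEq α]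
    [DecidableEq β] {Ωa : Matrix α α ℝ} {Ωb : Matrix β β ℝ} (ha : IsSympForm Ωa)
    (hb : IsSympForm Ωb) : IsSympForm (fromBlocks Ωa 0 0 Ωb) where
  transpose_eq := by
    simp [fromBlocks_transpose, fromBlocks_neg, ha.transpose_eq, hb.transpose_eq]
  mul_transpose := by
    simp [fromBlocks_transpose, fromBlocks_multiply, ha.mul_transpose, hb.mul_transpose]

theorem isSympForm_Omg (n : ℕ) : IsSympForm (Omg n) where
  transpose_eq := by simp [Omg, fromBlocks_transpose, fromBlocks_neg]
  mul_transpose := by simp [Omg, fromBlocks_transpose, fromBlocks_multiply]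

/-- The uncertainty relation `V + iΩ ≥ 0`, written with a real block matrix. -/
def IsRealQCM {N : Type*} (Ω V : Matrix N N ℝ) : Prop :=
  (fromBlocks V Ω Ωᵀ V).PosSemidef

theorem IsRealQCM.submatrix {M N : Type*} {Ω V : Matrix N N ℝ} (hV : IsRealQCM Ω V) (f : M → N) :
    IsRealQCM (Ω.submatrix f f) (V.submatrix f f) := by
  have := PosSemidef.submatrix hV (Sum.map f f)
  rw [IsRealQCM]
  convert this using 1
  ext (i | i) (j | j) <;> rfl

variable {N : Type*} [Fintype N] [DecidableEq N] {Ω V G : Matrix N N ℝ}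

theorem IsQCM.isRealQCM (hΩ : IsSympForm Ω) (hV : IsQCM Ω V) : IsRealQCM Ω V := by
  have hVH : V.IsHermitian := by
    rw [IsHermitian, conjTranspose_eq_transpose_of_trivial]
    exact hV.1
  refine PosSemidef.of_dotProduct_mulVec_nonneg (hVH.fromBlocks rfl hVH) fun x => ?_
  have h := hV.2.dotProduct_mulVec_nonneg
    (fun i => (x (Sum.inl i) : ℂ) - Complex.I * (x (Sum.inr i) : ℂ))
  have h' := (Complex.le_def.mp h).1
  refine h'.trans_eq ?_
  simp only [dotProduct, mulVec, cplx, Fintype.sum_sum_type, Complex.re_sum]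
  have hs : ∀ i j, Ω j i = - Ω i j := fun i j => congrFun (congrFun hΩ.transpose_eq i) j
  have e : ∑ i, ∑ j, x (Sum.inr i) * (Ω j i * x (Sum.inl j)) =
      -∑ i, ∑ j, x (Sum.inr i) * (Ω i j * x (Sum.inl j)) := by
    simp only [← Finset.sum_neg_distrib]
    refine Finset.sum_congr rfl fun i _ => Finset.sum_congr rfl fun j _ => ?_
    rw [hs i j]
    ring
  simp [Finset.mul_sum, Complex.re_sum, Complex.mul_re, Complex.mul_im, Finset.sum_add_distrib,
    mul_add]
  linarith

theorem IsRealQCM.posDef (hΩ : IsSympForm Ω) (hV : IsRealQCM Ω V) : V.PosDef := by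
  have hVs : V.PosSemidef := PosSemidef.submatrix hV Sum.inl
  refine PosDef.of_dotProduct_mulVec_pos hVs.isHermitian fun x hx => ?_
  refine lt_of_le_of_ne (hVs.dotProduct_mulVec_nonneg x) fun h0 => hx ?_
  have h1 := (PosSemidef.dotProduct_mulVec_zero_iff hV (Sum.elim x 0)).mp <| by
    rw [fromBlocks_mulVec]
    simpa [dotProduct] using h0.symm
  rw [fromBlocks_mulVec] at h1
  have h2 : Ωᵀ *ᵥ x = 0 := by
    funext i
    simpa using congrFun h1 (Sum.inr i)
  rw [← one_mulVec x, ← hΩ.mul_transpose, ← mulVec_mulVec, h2, mulVec_zero]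

theorem IsRealQCM.posSemidef_sub (hΩ : IsSympForm Ω) (hV : IsRealQCM Ω V) :
    (V - Ω * V⁻¹ * Ωᵀ).PosSemidef := by
  have hp := hV.posDef hΩ
  have : Invertible V := invertibleOfIsUnitDet _ hp.isUnit_det
  exact (PosDef.fromBlocks₂₂ V Ω hp).mp hV

/-- A positive definite matrix which is itself symplectic is a pure quantum covariance matrix. -/
theorem isPureQCM_of_mul_mul_eq (hΩs : IsSympForm Ω) (hG : G.PosDef)
    (h : G * Ω * G = Ω) : IsPureQCM Ω G := by
  obtain ⟨H, hH, rfl⟩ := hG.exists_sq_eq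
  have hHt : Hᵀ = H := hH.isHermitian
  have hu := hH.isUnit_det
  obtain ⟨hΩ, hΩ'⟩ := hΩs
  have hΩ'' : Ωᵀ * Ω = 1 := mul_eq_one_comm.mp hΩ'
  have hK : (Ω * H⁻¹ * Ωᵀ).PosDef := by
    have := hH.inv.conjTranspose_mul_mul_same (B := Ωᵀ)
      (mulVec_injective_of_isUnit (IsUnit.of_mul_eq_one _ hΩ''))
    simpa using this
  have hHK : H = Ω * H⁻¹ * Ωᵀ := by
    refine hH.eq_of_mul_self_eq hK ?_
    calc H * H = H * H * (Ω * (H * (H * H⁻¹) * H⁻¹) * Ωᵀ) := by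
          rw [mul_nonsing_inv _ hu, Matrix.mul_one, mul_nonsing_inv _ hu, Matrix.mul_one, hΩ',
            Matrix.mul_one]
      _ = (H * H * Ω * (H * H)) * (H⁻¹ * H⁻¹) * Ωᵀ := by simp only [Matrix.mul_assoc]
      _ = Ω * H⁻¹ * 1 * H⁻¹ * Ωᵀ := by rw [h, Matrix.mul_one]; simp only [Matrix.mul_assoc]
      _ = Ω * H⁻¹ * Ωᵀ * (Ω * H⁻¹ * Ωᵀ) := by rw [← hΩ'']; simp only [Matrix.mul_assoc]
  refine ⟨H, ?_, by rw [hHt]⟩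
  rw [IsSymplectic, hHt]
  calc H * Ω * H = Ω * H⁻¹ * Ωᵀ * Ω * H := by rw [← hHK]
    _ = Ω * (H⁻¹ * (Ωᵀ * Ω) * H) := by simp only [Matrix.mul_assoc]
    _ = Ω := by rw [hΩ'', Matrix.mul_one, nonsing_inv_mul _ hu, Matrix.mul_one]

/-- The geometric mean of `V` and `Ω V⁻¹ Ωᵀ` is positive definite and symplectic. -/
theorem Matrix.PosDef.exists_geomMean_symplectic (hΩs : IsSympForm Ω)
    (hV : V.PosDef) :
    ∃ G : Matrix N N ℝ, G.PosDef ∧ G * Ω * G = Ω ∧ G * V⁻¹ * G = Ω * V⁻¹ * Ωᵀ := by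
  obtain ⟨H, hH, rfl⟩ := hV.exists_sq_eq
  have hHt : Hᵀ = H := hH.isHermitian
  have hHit : H⁻¹ᵀ = H⁻¹ := hH.inv.isHermitian
  have hu := hH.isUnit_det
  have h1 : H * H⁻¹ = 1 := mul_nonsing_inv _ hu
  have h2 : H⁻¹ * H = 1 := nonsing_inv_mul _ hu
  obtain ⟨hΩ, hΩ'⟩ := hΩs
  set L := H⁻¹ * Ω * H⁻¹ with hL
  have hLt : Lᵀ = -L := by
    simp [hL, hHit, hΩ, Matrix.mul_assoc]
  have hLunit : L * (H * Ωᵀ * H) = 1 := by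
    calc L * (H * Ωᵀ * H) = H⁻¹ * (Ω * (H⁻¹ * H) * Ωᵀ) * H := by
          rw [hL]; simp only [Matrix.mul_assoc]
      _ = 1 := by rw [h2, Matrix.mul_one, hΩ', Matrix.mul_one, h2]
  have hLu : IsUnit L := IsUnit.of_mul_eq_one _ hLunit
  have hLtu : IsUnit Lᵀ := by rw [hLt]; exact hLu.neg
  have hC : (Lᵀ * L).PosDef :=
    PosDef.conjTranspose_mul_self L (mulVec_injective_of_isUnit hLu)
  obtain ⟨R, hR, hRR⟩ := hC.exists_sq_eq
  have hRu := hR.isUnit_det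
  have hRi : R * R⁻¹ = 1 := mul_nonsing_inv _ hRu
  have hRi' : R⁻¹ * R = 1 := nonsing_inv_mul _ hRu
  have hRL : R = Lᵀ * R⁻¹ * L := by
    refine hR.eq_of_mul_self_eq
      (hR.inv.conjTranspose_mul_mul_same (mulVec_injective_of_isUnit hLu)) ?_
    have hcomm : L * Lᵀ = R * R := by rw [hRR, hLt]; simp
    calc R * R = Lᵀ * 1 * 1 * L := by rw [hRR]; simp
      _ = Lᵀ * (R⁻¹ * R) * (R * R⁻¹) * L := by rw [hRi, hRi']
      _ = Lᵀ * R⁻¹ * (R * R) * R⁻¹ * L := by simp only [Matrix.mul_assoc]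
      _ = Lᵀ * R⁻¹ * L * (Lᵀ * R⁻¹ * L) := by rw [← hcomm]; simp only [Matrix.mul_assoc]
  have hHL : H * L * H = Ω := by
    calc H * L * H = (H * H⁻¹) * Ω * (H⁻¹ * H) := by rw [hL]; simp only [Matrix.mul_assoc]
      _ = Ω := by rw [h1, h2, Matrix.one_mul, Matrix.mul_one]
  refine ⟨H * R * H, ?_, ?_, ?_⟩
  · have := hR.conjTranspose_mul_mul_same (mulVec_injective_of_isUnit hH.isUnit)
    rwa [hH.isHermitian.eq] at this
  · have hX : L * (H * Ω * H) = -1 := by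
      rw [← hLunit, hΩ]
      simp
    calc H * R * H * Ω * (H * R * H) = H * (R * (H * Ω * H) * R) * H := by
          simp only [Matrix.mul_assoc]
      _ = H * (Lᵀ * R⁻¹ * (L * (H * Ω * H)) * R) * H := by
          conv_lhs => enter [1, 2, 1, 1]; rw [hRL]
          simp only [Matrix.mul_assoc]
      _ = H * (L * (R⁻¹ * R)) * H := by
          rw [hX, hLt]; simp [Matrix.mul_assoc]
      _ = Ω := by rw [hRi', Matrix.mul_one, hHL]
  · rw [mul_inv_rev]
    calc H * R * H * (H⁻¹ * H⁻¹) * (H * R * H) = H * R * (H * H⁻¹) * (H⁻¹ * H) * R * H := by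
          simp only [Matrix.mul_assoc]
      _ = H * (R * R) * H := by rw [h1, h2]; simp [Matrix.mul_assoc]
      _ = H * (L * Lᵀ) * H := by rw [hRR, hLt]; simp
      _ = (H * H⁻¹) * Ω * (H⁻¹ * H⁻¹) * Ωᵀ * (H⁻¹ * H) := by
          rw [hLt, hL, hΩ]; simp [Matrix.mul_assoc]
      _ = Ω * (H⁻¹ * H⁻¹) * Ωᵀ := by rw [h1, h2]; simp

theorem IsPureQCM.mul_mul_eq (hΩ : IsSympForm Ω) (hG : IsPureQCM Ω G) : G * Ω * G = Ω := by
  obtain ⟨S, hS, rfl⟩ := hG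
  rw [IsSymplectic] at hS
  have h1 : S * (Ω * Sᵀ * Ωᵀ) = 1 := by
    rw [← hΩ.mul_transpose]
    nth_rewrite 3 [← hS]
    simp only [Matrix.mul_assoc]
  have h2 : Sᵀ * Ωᵀ * S = Ωᵀ := by
    calc Sᵀ * Ωᵀ * S = (Ωᵀ * Ω) * Sᵀ * Ωᵀ * S := by rw [hΩ.transpose_mul, Matrix.one_mul]
      _ = Ωᵀ * ((Ω * Sᵀ * Ωᵀ) * S) := by simp only [Matrix.mul_assoc]
      _ = Ωᵀ := by rw [mul_eq_one_comm.mp h1, Matrix.mul_one]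
  have h3 : Sᵀ * Ω * S = Ω := by
    rw [hΩ.transpose_eq] at h2
    simpa using h2
  calc S * Sᵀ * Ω * (S * Sᵀ) = S * (Sᵀ * Ω * S) * Sᵀ := by simp only [Matrix.mul_assoc]
    _ = Ω := by rw [h3, hS]

theorem IsSympForm.det_mul_det (hΩ : IsSympForm Ω) : Ω.det * Ω.det = 1 := by
  have := congrArg det hΩ.mul_transpose
  rwa [det_mul, det_transpose, det_one] at this

theorem IsSympForm.det_conj (hΩ : IsSympForm Ω) (A : Matrix N N ℝ) :
    (Ω * A * Ωᵀ).det = A.det := by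
  rw [det_mul, det_mul, det_transpose, mul_right_comm, hΩ.det_mul_det, one_mul]

theorem IsPureQCM.det_eq_one (hΩ : IsSympForm Ω) (hG : IsPureQCM Ω G) : G.det = 1 := by
  obtain ⟨S, hS, rfl⟩ := hG
  have h := congrArg det hS
  rw [det_mul, det_mul, det_transpose] at h
  rw [det_mul, det_transpose]
  have := hΩ.det_mul_det
  linear_combination Ω.det * h + (1 - S.det * S.det) * this

theorem IsPureQCM.posDef (hΩ : IsSympForm Ω) (hG : IsPureQCM Ω G) : G.PosDef := by
  have hdet := hG.det_eq_one hΩ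
  obtain ⟨S, -, rfl⟩ := hG
  refine (posSemidef_self_mul_conjTranspose S).posDef_iff_det_ne_zero.mpr ?_
  rw [conjTranspose_eq_transpose_of_trivial, hdet]
  exact one_ne_zero

theorem IsPureQCM.inv_eq (hΩ : IsSympForm Ω) (hG : IsPureQCM Ω G) : G⁻¹ = Ω * G * Ωᵀ := by
  refine inv_eq_right_inv ?_
  rw [← Matrix.mul_assoc, ← Matrix.mul_assoc, hG.mul_mul_eq hΩ, hΩ.mul_transpose]

theorem IsPureQCM.isRealQCM (hΩ : IsSympForm Ω) (hG : IsPureQCM Ω G) : IsRealQCM Ω G := by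
  have hp := hG.posDef hΩ
  have : Invertible G := invertibleOfIsUnitDet _ hp.isUnit_det
  refine (PosDef.fromBlocks₂₂ G Ω hp).mpr ?_
  have e : Ω * (Ω * G * Ωᵀ) * Ωᵀ = G := by
    have h2 : Ω * Ω = -1 := by
      rw [← hΩ.mul_transpose, hΩ.transpose_eq]; simp
    have h3 : Ωᵀ * Ωᵀ = -1 := by
      rw [← transpose_mul, h2]; simp
    calc Ω * (Ω * G * Ωᵀ) * Ωᵀ = (Ω * Ω) * G * (Ωᵀ * Ωᵀ) := by simp only [Matrix.mul_assoc]
      _ = G := by rw [h2, h3]; simp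
  rw [conjTranspose_eq_transpose_of_trivial, hG.inv_eq hΩ, e, sub_self]
  exact PosSemidef.zero

end Symplectic

section Bipartite

variable {α β : Type*} [Fintype α] [Fintype β] [DecidableEq α] [DecidableEq β]
  {Ωa : Matrix α α ℝ} {Ωb : Matrix β β ℝ} {V : Matrix (α ⊕ β) (α ⊕ β) ℝ}

theorem IsPureQCM.det_submatrix_eq {N : Type*} [Fintype N] [DecidableEq N] {Ω G : Matrix N N ℝ}
    (hb : IsSympForm Ωb) (hΩ : IsSympForm Ω) (hG : IsPureQCM Ω G) (e : α ⊕ β ≃ N)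
    (he : Ω.submatrix e e = fromBlocks Ωa 0 0 Ωb) :
    (G.submatrix (e ∘ Sum.inl) (e ∘ Sum.inl)).det =
      (G.submatrix (e ∘ Sum.inr) (e ∘ Sum.inr)).det := by
  have h := det_mul_det_inv_toBlocks₂₂ (G.submatrix e e)
    (by rw [det_submatrix_equiv_self]; exact (hG.posDef hΩ).isUnit_det)
  have hinv : (G.submatrix e e)⁻¹ =
      fromBlocks Ωa 0 0 Ωb * G.submatrix e e * (fromBlocks Ωa 0 0 Ωb)ᵀ := by
    rw [← he, inv_submatrix_equiv, hG.inv_eq hΩ, transpose_submatrix, submatrix_mul_equiv,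
      submatrix_mul_equiv]
  have hb2 : ((G.submatrix e e)⁻¹).toBlocks₂₂ = Ωb * (G.submatrix e e).toBlocks₂₂ * Ωbᵀ := by
    rw [hinv]
    conv_lhs => rw [← fromBlocks_toBlocks (G.submatrix e e)]
    simp [fromBlocks_transpose, fromBlocks_multiply]
  rw [det_submatrix_equiv_self, hG.det_eq_one hΩ, one_mul, hb2, hb.det_conj] at h
  exact h.symm

/-- Below every quantum covariance matrix there is a pure one whose log-det mutual information
is no larger. -/
theorem IsRealQCM.exists_isPureQCM_le (ha : IsSympForm Ωa) (hb : IsSympForm Ωb)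
    (hV : IsRealQCM (fromBlocks Ωa 0 0 Ωb) V) :
    ∃ γ, IsPureQCM (fromBlocks Ωa 0 0 Ωb) γ ∧ (V - γ).PosSemidef ∧ IM2 γ ≤ IM2 V := by
  have hΩ := ha.fromBlocks hb
  have hVp := hV.posDef hΩ
  obtain ⟨G, hG, hGG, hGV⟩ := hVp.exists_geomMean_symplectic hΩ
  have hpure := isPureQCM_of_mul_mul_eq hΩ hG hGG
  have hGt : Gᴴ = G := hG.isHermitian
  have hblk : (fromBlocks V G G
      (fromBlocks Ωa 0 0 Ωb * V⁻¹ * (fromBlocks Ωa 0 0 Ωb)ᵀ)).PosSemidef := by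
    have : Invertible V := invertibleOfIsUnitDet _ hVp.isUnit_det
    have := (PosDef.fromBlocks₁₁ G (G * V⁻¹ * G) hVp).mpr (by
      rw [hGt, sub_self]; exact PosSemidef.zero)
    rwa [hGt, hGV] at this
  refine ⟨G, hpure, hblk.sub_of_fromBlocks (hV.posSemidef_sub hΩ), ?_⟩
  have hconj : fromBlocks Ωa 0 0 Ωb * V⁻¹ * (fromBlocks Ωa 0 0 Ωb)ᵀ =
      fromBlocks (Ωa * V⁻¹.toBlocks₁₁ * Ωaᵀ) (Ωa * V⁻¹.toBlocks₁₂ * Ωbᵀ)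
        (Ωb * V⁻¹.toBlocks₂₁ * Ωaᵀ) (Ωb * V⁻¹.toBlocks₂₂ * Ωbᵀ) := by
    conv_lhs => rw [← fromBlocks_toBlocks V⁻¹]
    simp [fromBlocks_transpose, fromBlocks_multiply]
  rw [hconj] at hblk
  have h1 : G.toBlocks₁₁.det ^ 2 ≤ V.toBlocks₁₁.det * V⁻¹.toBlocks₁₁.det := by
    rw [← ha.det_conj V⁻¹.toBlocks₁₁]
    refine det_sq_le_of_posSemidef_fromBlocks hVp.toBlocks₁₁ hG.toBlocks₁₁ ?_
    convert hblk.submatrix (Sum.map (Sum.inl : α → α ⊕ β) (Sum.inl : α → α ⊕ β)) using 1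
    ext (i | i) (j | j) <;> rfl
  have h2 : G.toBlocks₂₂.det ^ 2 ≤ V.toBlocks₂₂.det * V⁻¹.toBlocks₂₂.det := by
    rw [← hb.det_conj V⁻¹.toBlocks₂₂]
    refine det_sq_le_of_posSemidef_fromBlocks hVp.toBlocks₂₂ hG.toBlocks₂₂ ?_
    convert hblk.submatrix (Sum.map (Sum.inr : β → α ⊕ β) (Sum.inr : β → α ⊕ β)) using 1
    ext (i | i) (j | j) <;> rfl
  have j1 := det_mul_det_inv_toBlocks₁₁ V hVp.isUnit_det
  have j2 := det_mul_det_inv_toBlocks₂₂ V hVp.isUnit_det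
  have pd := hVp.det_pos
  have pG1 := hG.toBlocks₁₁.det_pos
  have pG2 := hG.toBlocks₂₂.det_pos
  have p1 := hVp.toBlocks₁₁.det_pos
  have p2 := hVp.toBlocks₂₂.det_pos
  rw [mul_comm, ← eq_div_iff pd.ne'] at j1 j2
  rw [j1, ← mul_div_assoc] at h1
  rw [j2, ← mul_div_assoc, mul_comm V.toBlocks₂₂.det] at h2
  rw [IM2, IM2, hpure.det_eq_one hΩ, div_one]
  have hle : G.toBlocks₁₁.det * G.toBlocks₂₂.det ≤
      V.toBlocks₁₁.det * V.toBlocks₂₂.det / V.det := by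
    refine (sq_le_sq₀ (by positivity) (by positivity)).mp ?_
    rw [mul_pow, sq (_ / _)]
    exact mul_le_mul h1 h2 (by positivity) (by positivity)
  have := Real.log_le_log (by positivity) hle
  linarith

theorem IM2_nonneg (hV : V.PosDef) : 0 ≤ IM2 V := by
  refine mul_nonneg (by norm_num) (Real.log_nonneg ?_)
  rw [one_le_div hV.det_pos]
  exact hV.det_le_mul_det_toBlocks

theorem EF2_le_half_IM2 (ha : IsSympForm Ωa) (hb : IsSympForm Ωb) {W : Matrix (α ⊕ β) (α ⊕ β) ℝ}
    (hW : IsRealQCM (fromBlocks Ωa 0 0 Ωb) W) (hWV : (V - W).PosSemidef) :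
    EF2 (fromBlocks Ωa 0 0 Ωb) V ≤ (1 / 2) * IM2 W := by
  obtain ⟨γ, hγ, hle, hI⟩ := hW.exists_isPureQCM_le ha hb
  refine le_trans (b := 1 / 2 * IM2 γ) (csInf_le ⟨0, ?_⟩ ⟨γ, hγ, ?_, rfl⟩) (by linarith)
  · rintro _ ⟨γ', hγ', -, rfl⟩
    have := IM2_nonneg (hγ'.posDef (ha.fromBlocks hb))
    positivity
  · have := hWV.add hle
    rwa [sub_add_sub_cancel] at this

end Bipartite

theorem submatrix_eAB_fromBlocks {α β γ : Type*} {Ωa : Matrix α α ℝ} {Ωb : Matrix β β ℝ}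
    {Ωc : Matrix γ γ ℝ} :
    (fromBlocks Ωa 0 0 (fromBlocks Ωb 0 0 Ωc)).submatrix eAB eAB = fromBlocks Ωa 0 0 Ωb := by
  ext (i | i) (j | j) <;> rfl

theorem submatrix_eAC_fromBlocks {α β γ : Type*} {Ωa : Matrix α α ℝ} {Ωb : Matrix β β ℝ}
    {Ωc : Matrix γ γ ℝ} :
    (fromBlocks Ωa 0 0 (fromBlocks Ωb 0 0 Ωc)).submatrix eAC eAC = fromBlocks Ωa 0 0 Ωc := by
  ext (i | i) (j | j) <;> rfl

section Tripartite

variable {α β γ : Type*} [Fintype α] [Fintype β] [Fintype γ] [DecidableEq α] [DecidableEq β]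
  [DecidableEq γ] {Ωa : Matrix α α ℝ} {Ωb : Matrix β β ℝ} {Ωc : Matrix γ γ ℝ}
  {V G : Matrix (α ⊕ (β ⊕ γ)) (α ⊕ (β ⊕ γ)) ℝ}

/-- On a pure state the mutual information between `A` and `BC` is additive. -/
theorem IsPureQCM.IM2_eq_add (ha : IsSympForm Ωa) (hb : IsSympForm Ωb) (hc : IsSympForm Ωc)
    (hG : IsPureQCM (fromBlocks Ωa 0 0 (fromBlocks Ωb 0 0 Ωc)) G) :
    IM2 G = IM2 (G.submatrix eAB eAB) + IM2 (G.submatrix eAC eAC) := by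
  have hΩ := ha.fromBlocks (hb.fromBlocks hc)
  have hp := hG.posDef hΩ
  have hA : G.toBlocks₁₁.det = G.toBlocks₂₂.det :=
    hG.det_submatrix_eq (hb.fromBlocks hc) hΩ (Equiv.refl _) rfl
  have hAB : (G.submatrix eAB eAB).det = G.toBlocks₂₂.toBlocks₂₂.det := by
    have h := hG.det_submatrix_eq hc hΩ (Equiv.sumAssoc α β γ) (Ωa := fromBlocks Ωa 0 0 Ωb)
      (by ext ((i | i) | i) ((j | j) | j) <;> rfl)
    have e : Equiv.sumAssoc α β γ ∘ Sum.inl = eAB := by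
      funext i; rcases i with i | i <;> rfl
    rw [e] at h
    exact h
  have hAC : (G.submatrix eAC eAC).det = G.toBlocks₂₂.toBlocks₁₁.det := by
    have h := hG.det_submatrix_eq hb hΩ
      ((Equiv.sumAssoc α γ β).trans ((Equiv.refl α).sumCongr (Equiv.sumComm γ β)))
      (Ωa := fromBlocks Ωa 0 0 Ωc) (by ext ((i | i) | i) ((j | j) | j) <;> rfl)
    have e : (Equiv.sumAssoc α γ β).trans ((Equiv.refl α).sumCongr (Equiv.sumComm γ β)) ∘ Sum.inl =
        eAC := by
      funext i; rcases i with i | i <;> rfl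
    rw [e] at h
    exact h
  have hA1 : (G.submatrix eAB eAB).toBlocks₁₁ = G.toBlocks₁₁ := rfl
  have hA2 : (G.submatrix eAC eAC).toBlocks₁₁ = G.toBlocks₁₁ := rfl
  have hB : (G.submatrix eAB eAB).toBlocks₂₂ = G.toBlocks₂₂.toBlocks₁₁ := rfl
  have hC : (G.submatrix eAC eAC).toBlocks₂₂ = G.toBlocks₂₂.toBlocks₂₂ := rfl
  have pa := hp.toBlocks₁₁.det_pos
  have pb := hp.toBlocks₂₂.toBlocks₁₁.det_pos
  have pc := hp.toBlocks₂₂.toBlocks₂₂.det_pos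
  rw [IM2, IM2, IM2, hAB, hAC, hA1, hA2, hB, hC, ← hA, hG.det_eq_one hΩ, ← mul_add,
    ← Real.log_mul (by positivity) (by positivity)]
  congr 2
  field_simp

/-- Monogamy for abstract symplectic forms. -/
theorem EF2_monogamy (ha : IsSympForm Ωa) (hb : IsSympForm Ωb) (hc : IsSympForm Ωc)
    (hV : IsRealQCM (fromBlocks Ωa 0 0 (fromBlocks Ωb 0 0 Ωc)) V) :
    EF2 (fromBlocks Ωa 0 0 Ωb) (V.submatrix eAB eAB) +
        EF2 (fromBlocks Ωa 0 0 Ωc) (V.submatrix eAC eAC) ≤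
      EF2 (fromBlocks Ωa 0 0 (fromBlocks Ωb 0 0 Ωc)) V := by
  have hΩ := ha.fromBlocks (hb.fromBlocks hc)
  obtain ⟨γ₀, hγ₀, hle₀, -⟩ := hV.exists_isPureQCM_le ha (hb.fromBlocks hc)
  refine le_csInf ⟨_, γ₀, hγ₀, hle₀, rfl⟩ ?_
  rintro _ ⟨G, hG, hle, rfl⟩
  have hGr := hG.isRealQCM hΩ
  have hAB : IsRealQCM (fromBlocks Ωa 0 0 Ωb) (G.submatrix eAB eAB) := by
    have := hGr.submatrix eAB
    rwa [submatrix_eAB_fromBlocks] at this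
  have hAC : IsRealQCM (fromBlocks Ωa 0 0 Ωc) (G.submatrix eAC eAC) := by
    have := hGr.submatrix eAC
    rwa [submatrix_eAC_fromBlocks] at this
  have h1 : EF2 (fromBlocks Ωa 0 0 Ωb) (V.submatrix eAB eAB) ≤ _ :=
    EF2_le_half_IM2 ha hb hAB (hle.submatrix eAB)
  have h2 : EF2 (fromBlocks Ωa 0 0 Ωc) (V.submatrix eAC eAC) ≤ _ :=
    EF2_le_half_IM2 ha hc hAC (hle.submatrix eAC)
  rw [hG.IM2_eq_add ha hb hc, mul_add]
  exact add_le_add h1 h2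

end Tripartite

/-- monogamy: for every tripartite QCM `V_ABC`,
`E^G_{F,2}(A:BC) ≥ E^G_{F,2}(A:B) + E^G_{F,2}(A:C)`. -/
theorem stmt18 {nA nB nC : ℕ}
    (V : Matrix ((Fin nA ⊕ Fin nA) ⊕ ((Fin nB ⊕ Fin nB) ⊕ (Fin nC ⊕ Fin nC)))
      ((Fin nA ⊕ Fin nA) ⊕ ((Fin nB ⊕ Fin nB) ⊕ (Fin nC ⊕ Fin nC))) ℝ)
    (hV : IsQCM (fromBlocks (Omg nA) 0 0 (fromBlocks (Omg nB) 0 0 (Omg nC))) V) :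
    EF2 (fromBlocks (Omg nA) 0 0 (fromBlocks (Omg nB) 0 0 (Omg nC))) V ≥
      EF2 (fromBlocks (Omg nA) 0 0 (Omg nB)) (V.submatrix eAB eAB) +
        EF2 (fromBlocks (Omg nA) 0 0 (Omg nC)) (V.submatrix eAC eAC) := by
  have hA := isSympForm_Omg nA
  have hB := isSympForm_Omg nB
  have hC := isSympForm_Omg nC
  exact EF2_monogamy hA hB hC (hV.isRealQCM (hA.fromBlocks (hB.fromBlocks hC)))
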